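/- (A single driver node controls a network with fully independent self-loops) Let A be an N×N matrix with rational entries and N ≥ 1, and let Λ be a real diagonal N×N matrix whose N diagonal entries are algebraically independent over ℚ. Then there exists a vector b ∈ ℝ^N such that the N×N matrix [b, (A+Λ)b, (A+Λ)²b, …, (A+Λ)^{N−1}b] has rank N; that is, the minimum number of driver nodes of A + Λ is 1. -/

import Mathlib

/-- The single-input controllability matrix of `(Φ, b)`: the `N × N` matrix whose `k`-th
column is `Φ^k b`. -/
def singleInputCtrbMatrix {F : Type*} [Field F] {N : ℕ}
    (Φ : Matrix (Fin N) (Fin N) F) (b : Fin N → F) :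
    Matrix (Fin N) (Fin N) F :=
  Matrix.of fun i k => (Φ ^ (k : ℕ)).mulVec b i

/-- The controllability (Kalman) matrix `[B, ΦB, Φ²B, …, Φ^{N−1}B]` of the pair `(Φ, B)`. -/
def ctrbMatrix {F : Type*} [Field F] {N M : ℕ}
    (Φ : Matrix (Fin N) (Fin N) F) (B : Matrix (Fin N) (Fin M) F) :
    Matrix (Fin N) (Fin N × Fin M) F :=
  Matrix.of fun i p => (Φ ^ (p.1 : ℕ) * B) i p.2

open Polynomial in
/-- A nonzero polynomial over an infinite domain is nonzero at some nonzero point. -/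
theorem Polynomial.exists_ne_zero_eval_ne_zero {R : Type*} [CommRing R] [IsDomain R] [Infinite R]
    {p : R[X]} (hp : p ≠ 0) : ∃ s : R, s ≠ 0 ∧ p.eval s ≠ 0 := by
  by_contra! h
  refine mul_ne_zero X_ne_zero hp (Polynomial.funext fun s => ?_)
  by_cases hs : s = 0
  · simp [hs]
  · simp [h s hs]

/-- The Krylov matrix of `M` at the all-ones vector: its `k`-th column is `M ^ k * 1`. -/
def onesKrylovMatrix {R : Type*} [CommRing R] {N : ℕ} (M : Matrix (Fin N) (Fin N) R) :
    Matrix (Fin N) (Fin N) R :=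
  Matrix.of fun i k => (M ^ (k : ℕ)).mulVec 1 i

theorem map_det_onesKrylovMatrix {R S : Type*} [CommRing R] [CommRing S] {N : ℕ} (f : R →+* S)
    (M : Matrix (Fin N) (Fin N) R) :
    f (onesKrylovMatrix M).det = (onesKrylovMatrix (M.map f)).det := by
  rw [RingHom.map_det]
  congr 1
  ext i k
  have h : (M.map f) ^ (k : ℕ) = (M ^ (k : ℕ)).map f := (map_pow f.mapMatrix M k).symm
  simp [onesKrylovMatrix, h, Matrix.mulVec, dotProduct]

theorem det_onesKrylovMatrix_smul {R : Type*} [CommRing R] {N : ℕ} (s : R)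
    (M : Matrix (Fin N) (Fin N) R) :
    (onesKrylovMatrix (s • M)).det = (∏ k : Fin N, s ^ (k : ℕ)) * (onesKrylovMatrix M).det := by
  rw [← Matrix.det_mul_row]
  congr 1
  ext i k
  simp [onesKrylovMatrix, smul_pow, Matrix.smul_mulVec]

theorem onesKrylovMatrix_diagonal {R : Type*} [CommRing R] {N : ℕ} (v : Fin N → R) :
    onesKrylovMatrix (Matrix.diagonal v) = Matrix.vandermonde v := by
  ext i k
  simp [onesKrylovMatrix, Matrix.diagonal_pow, Matrix.mulVec_diagonal, Matrix.vandermonde]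

open Polynomial in
/-- Any matrix over an infinite field becomes cyclic with respect to the all-ones vector after
adding a suitable diagonal matrix. -/
theorem exists_det_onesKrylovMatrix_add_diagonal_ne_zero {F : Type*} [Field F] [Infinite F]
    {N : ℕ} (A : Matrix (Fin N) (Fin N) F) :
    ∃ x : Fin N → F, (onesKrylovMatrix (A + Matrix.diagonal x)).det ≠ 0 := by
  let v : Fin N → F := fun i => Infinite.natEmbedding F i
  have hv : Function.Injective v :=
    (Infinite.natEmbedding F).injective.comp Fin.val_injective
  let p : F[X] := (onesKrylovMatrix ((X : F[X]) • A.map C + (Matrix.diagonal v).map C)).det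
  have hp (s : F) : p.eval s = (onesKrylovMatrix (s • A + Matrix.diagonal v)).det := by
    rw [← Polynomial.coe_evalRingHom, map_det_onesKrylovMatrix]
    congr 2
    ext i j
    obtain rfl | hij := eq_or_ne i j
    · simp; ring
    · simp [hij]; ring
  have hp0 : p ≠ 0 := fun h => by
    have h0 := hp 0
    rw [h, zero_smul, zero_add, onesKrylovMatrix_diagonal, eval_zero] at h0
    exact Matrix.det_vandermonde_ne_zero_iff.mpr hv h0.symm
  obtain ⟨s, hs, hps⟩ := Polynomial.exists_ne_zero_eval_ne_zero hp0
  refine ⟨s⁻¹ • v, fun h => hps ?_⟩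
  have hM : s • A + Matrix.diagonal v = s • (A + Matrix.diagonal (s⁻¹ • v)) := by
    rw [smul_add, ← Matrix.diagonal_smul, smul_inv_smul₀ hs]
  rw [hp, hM, det_onesKrylovMatrix_smul, h, mul_zero]

/-- Adding an algebraically independent diagonal makes the all-ones vector cyclic. -/
theorem det_onesKrylovMatrix_ne_zero_of_algebraicIndependent {F K : Type*} [Field F] [Infinite F]
    [CommRing K] [Algebra F K] {N : ℕ} (A : Matrix (Fin N) (Fin N) F) {d : Fin N → K}
    (hd : AlgebraicIndependent F d) :
    (onesKrylovMatrix (A.map (algebraMap F K) + Matrix.diagonal d)).det ≠ 0 := by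
  let G : Matrix (Fin N) (Fin N) (MvPolynomial (Fin N) F) :=
    A.map MvPolynomial.C + Matrix.diagonal MvPolynomial.X
  have hGd : MvPolynomial.aeval d (onesKrylovMatrix G).det =
      (onesKrylovMatrix (A.map (algebraMap F K) + Matrix.diagonal d)).det := by
    rw [← AlgHom.coe_toRingHom, map_det_onesKrylovMatrix]
    congr 2
    ext i j
    by_cases hij : i = j <;> simp [G, hij]
  have hGx (x : Fin N → F) : MvPolynomial.eval x (onesKrylovMatrix G).det =
      (onesKrylovMatrix (A + Matrix.diagonal x)).det := by
    rw [map_det_onesKrylovMatrix]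
    congr 2
    ext i j
    by_cases hij : i = j <;> simp [G, hij]
  obtain ⟨x, hx⟩ := exists_det_onesKrylovMatrix_add_diagonal_ne_zero A
  intro h
  rw [← hGd, ← map_zero (MvPolynomial.aeval (R := F) d)] at h
  exact hx (by rw [← hGx, hd h, map_zero])

/-- A single driver node controls a network with fully independent self-loops: if `A` has
rational entries, `N ≥ 1`, and the self-loop weights `d 0, …, d (N−1)` are algebraically
independent over `ℚ`, then some `b ∈ ℝ^N` makes `[b, Φb, …, Φ^{N−1}b]` of `Φ = A + diagonal d`
have full rank `N`; that is, the minimum number of driver nodes of `A + diagonal d` is `1`. -/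
theorem single_driver_node_of_independent_selfloops {N : ℕ} (hN : 1 ≤ N)
    (A : Matrix (Fin N) (Fin N) ℚ) (d : Fin N → ℝ)
    (hd : AlgebraicIndependent ℚ d)
    (Φ : Matrix (Fin N) (Fin N) ℝ)
    (hΦ : Φ = A.map (Rat.cast : ℚ → ℝ) + Matrix.diagonal d) :
    (∃ b : Fin N → ℝ, (singleInputCtrbMatrix Φ b).rank = N) ∧
      sInf {M : ℕ | 1 ≤ M ∧ ∃ B : Matrix (Fin N) (Fin M) ℝ, (ctrbMatrix Φ B).rank = N} = 1 := by
  have hb : (singleInputCtrbMatrix Φ 1).rank = N := by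
    have hdet := det_onesKrylovMatrix_ne_zero_of_algebraicIndependent A hd
    have h : (singleInputCtrbMatrix Φ 1).det ≠ 0 := by
      rw [hΦ]
      exact hdet
    simpa using Matrix.rank_of_isUnit _ ((Matrix.isUnit_iff_isUnit_det _).mpr h.isUnit)
  have hmem : 1 ∈ {M : ℕ | 1 ≤ M ∧
      ∃ B : Matrix (Fin N) (Fin M) ℝ, (ctrbMatrix Φ B).rank = N} := by
    refine ⟨le_rfl, Matrix.of fun _ _ => 1, ?_⟩
    refine Eq.trans ?_ hb
    rw [← Matrix.rank_submatrix (singleInputCtrbMatrix Φ 1) (Equiv.refl _)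
      (Equiv.prodUnique (Fin N) (Fin 1))]
    rfl
  exact ⟨⟨1, hb⟩, le_antisymm (Nat.sInf_le hmem) (le_csInf ⟨1, hmem⟩ fun _ h => h.1)⟩
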